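/- Key Lyapunov contraction lemma for CC-DQM. Let M be a real matrix with MᵀM = 2L (acting blockwise on ℝ^{nd}); set r_0 = 0, r_{k+1} = r_k + (1/4) M y_{k+1}, and let r* be the unique vector in the range of M (blockwise) satisfying 2 c Mᵀ r* = −∇f(x*), where ∇f(x*) stacks the gradients ∇f_i(x̄*). Suppose c > 0 and δ satisfy: there exists β > ℓ²/(2 c λ₂ v) with G(β) > 0 and δ/(1−√δ)² < G(β)/(3 c λₙ + 2 c β λₙ + c λₙ²/(β λ₂)), where G(β) = c λ̂₁/2 − 4ℓ² c β λ₂/(4 c β λ₂ v − 2ℓ²) − (c² λ̂ₙ² + 4ℓ²)/(c β λ₂). Then there exist w > 0 and σ̂ > 0 such that the Lyapunov sequence V_k := (c/2)(x_k − x*)ᵀ L_s (x_k − x*) + 4c‖r_k − r*‖² + w‖e_k‖² satisfies, for all k ≥ 0, V_{k+1} ≤ V_k/(1 + σ̂) + n ψ μ_{k+1}², where ψ = w + (1/(1+σ̂)) (3 c λₙ/2 + 2 c β λₙ + (c β⁻¹ + 4 σ̂ c) λₙ²/(2 λ₂)). -/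

import Mathlib

open scoped RealInnerProductSpace BigOperators

noncomputable section

/-- Blockwise action of a matrix `A` on stacked vectors in `(ℝ^d)^n ≅ ℝ^{nd}`
(i.e. the action of `A ⊗ I_d`). -/
def blockMul {m n d : ℕ} (A : Matrix (Fin m) (Fin n) ℝ)
    (z : Fin n → EuclideanSpace ℝ (Fin d)) : Fin m → EuclideanSpace ℝ (Fin d) :=
  fun i => ∑ j, A i j • z j

/-- `t` is an eigenvalue of the real matrix `A`. -/
def IsEigenvalue {n : ℕ} (A : Matrix (Fin n) (Fin n) ℝ) (t : ℝ) : Prop :=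
  ∃ z : Fin n → ℝ, z ≠ 0 ∧ A.mulVec z = t • z

/-- The signed Laplacian `L = D - W` of a graph. -/
def signedLap {n : ℕ} (G : SimpleGraph (Fin n)) [DecidableRel G.Adj] :
    Matrix (Fin n) (Fin n) ℝ :=
  Matrix.diagonal (fun i => (G.degree i : ℝ)) - G.adjMatrix ℝ

/-- The unsigned Laplacian `L_s = D + W` of a graph. -/
def unsignedLap {n : ℕ} (G : SimpleGraph (Fin n)) [DecidableRel G.Adj] :
    Matrix (Fin n) (Fin n) ℝ :=
  Matrix.diagonal (fun i => (G.degree i : ℝ)) + G.adjMatrix ℝ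

/-- The CC-DQM iteration: initializations `y₀ = 0`, `φ₀ = 0`, the primal update
`x_{i,k+1} = x_{i,k} - (2 c dᵢ I + ∇²fᵢ(y_{i,k}))⁻¹ (∇fᵢ(x_{i,k}) + c Σ_{j ∈ Nᵢ} (y_{i,k} - y_{j,k}) + φ_{i,k})`,
the censored/compressed state update for `y`, and the dual update for `φ`. -/
def IsCCDQM {n d : ℕ} (G : SimpleGraph (Fin n)) [DecidableRel G.Adj]
    (f : Fin n → EuclideanSpace ℝ (Fin d) → ℝ) (c : ℝ) (μ : ℕ → ℝ)
    (C : EuclideanSpace ℝ (Fin d) → EuclideanSpace ℝ (Fin d))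
    (x y φ : ℕ → Fin n → EuclideanSpace ℝ (Fin d)) : Prop :=
  (∀ i, y 0 i = 0) ∧ (∀ i, φ 0 i = 0) ∧
  (∀ k i, x (k+1) i = x k i -
      Ring.inverse ((2 * c * (G.degree i : ℝ)) •
            (1 : EuclideanSpace ℝ (Fin d) →L[ℝ] EuclideanSpace ℝ (Fin d))
          + fderiv ℝ (gradient (f i)) (y k i))
        (gradient (f i) (x k i)
          + c • ∑ j ∈ G.neighborFinset i, (y k i - y k j) + φ k i)) ∧
  (∀ k i, y (k+1) i =
      if μ (k+1) ≤ ‖x (k+1) i - y k i‖ then y k i + C (x (k+1) i - y k i) else y k i) ∧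
  (∀ k i, φ (k+1) i = φ k i + c • ∑ j ∈ G.neighborFinset i, (y (k+1) i - y (k+1) j))

open Matrix

/-- The Lyapunov function `V = (c/2)(x-x*)ᵀ L_s (x-x*) + 4c‖r-r*‖² + w‖e‖²`. -/
def lyap {n m d : ℕ} (Ls : Matrix (Fin n) (Fin n) ℝ) (c w : ℝ)
    (xk ek : Fin n → EuclideanSpace ℝ (Fin d)) (rk : Fin m → EuclideanSpace ℝ (Fin d))
    (xstar : EuclideanSpace ℝ (Fin d)) (rstar : Fin m → EuclideanSpace ℝ (Fin d)) : ℝ :=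
  c / 2 * ∑ i, ⟪xk i - xstar, blockMul Ls (fun j => xk j - xstar) i⟫
    + 4 * c * ∑ j, ‖rk j - rstar j‖ ^ 2
    + w * ∑ i, ‖ek i‖ ^ 2

theorem norm_sq_add_five_le {E : Type*} [SeminormedAddCommGroup E] (a b c d e : E) :
    ‖a + b + c + d + e‖ ^ 2 ≤
      4 * ‖a‖ ^ 2 + 8 * ‖b‖ ^ 2 + 8 * ‖c‖ ^ 2 + 4 * ‖d‖ ^ 2 + 4 * ‖e‖ ^ 2 := by
  have h : ‖a + b + c + d + e‖ ≤ ‖a‖ + ‖b‖ + ‖c‖ + ‖d‖ + ‖e‖ := by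
    linarith [norm_add_le (a + b + c + d) e, norm_add_le (a + b + c) d, norm_add_le (a + b) c,
      norm_add_le a b]
  have h2 := pow_le_pow_left₀ (norm_nonneg _) h 2
  generalize ‖a‖ = a at *
  generalize ‖b‖ = b at *
  generalize ‖c‖ = c at *
  generalize ‖d‖ = d at *
  generalize ‖e‖ = e at *
  linarith [sq_nonneg (a - 2 * b), sq_nonneg (a - 2 * c), sq_nonneg (a - d), sq_nonneg (a - e),
    sq_nonneg (b - c), sq_nonneg (2 * b - d), sq_nonneg (2 * b - e), sq_nonneg (2 * c - d),
    sq_nonneg (2 * c - e), sq_nonneg (d - e)]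

theorem norm_smul_sq {E : Type*} [SeminormedAddCommGroup E] [NormedSpace ℝ E] (t : ℝ) (a : E) :
    ‖t • a‖ ^ 2 = t ^ 2 * ‖a‖ ^ 2 := by
  rw [norm_smul, mul_pow, Real.norm_eq_abs, sq_abs]

/-- One-step descent of the primal-dual part of the Lyapunov function: `z = x⁺ - x*`,
`p = x⁺ - x`, `u = r⁺ - r*`, `u₀ = r - r*`, and `e` and `e'` are the old and the new
compression error. -/
theorem primal_dual_descent {E F : Type*} [NormedAddCommGroup E] [InnerProductSpace ℝ E]
    [NormedAddCommGroup F] [InnerProductSpace ℝ F]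
    (L Ls : E →ₗ[ℝ] E) (M : E →ₗ[ℝ] F) (Mt : F →ₗ[ℝ] E)
    (hadj : ∀ a b, ⟪Mt a, b⟫ = ⟪a, M b⟫) (hMM : ∀ a, Mt (M a) = (2 : ℝ) • L a)
    (hLsym : ∀ a b, ⟪L a, b⟫ = ⟪a, L b⟫) (hLssym : ∀ a b, ⟪Ls a, b⟫ = ⟪a, Ls b⟫)
    {c β σ v ℓ lam2 lamn lh1 lhn : ℝ} (hc : 0 < c) (hβ : 0 < β) (hσ : 0 < σ) (hlam2 : 0 < lam2)
    (hL0 : ∀ a, 0 ≤ ⟪a, L a⟫) (hL1 : ∀ a, ⟪a, L a⟫ ≤ lamn * ‖a‖ ^ 2)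
    (hL2 : ∀ a, ‖L a‖ ^ 2 ≤ lamn ^ 2 * ‖a‖ ^ 2)
    (hLs0 : ∀ a, lh1 * ‖a‖ ^ 2 ≤ ⟪a, Ls a⟫) (hLs1 : ∀ a, ⟪a, Ls a⟫ ≤ lhn * ‖a‖ ^ 2)
    (hLs2 : ∀ a, ‖Ls a‖ ^ 2 ≤ lhn ^ 2 * ‖a‖ ^ 2)
    {z p e e' q g : E} {u u₀ : F}
    (hu : 2 * lam2 * ‖u‖ ^ 2 ≤ ‖Mt u‖ ^ 2)
    (heq : q + g + c • Ls p + c • L e - c • L e' + (2 * c) • Mt u = 0)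
    (hr : u = u₀ + (4 : ℝ)⁻¹ • M (z + e'))
    (hq0 : v * ‖z‖ ^ 2 ≤ ⟪q, z⟫) (hq1 : ‖q‖ ^ 2 ≤ ℓ ^ 2 * ‖z‖ ^ 2)
    (hg : ‖g‖ ^ 2 ≤ 4 * ℓ ^ 2 * ‖p‖ ^ 2)
    (ha : 0 < v - σ * (c * lhn / 2) - (1 / β + 4 * σ) * (ℓ ^ 2 / (2 * c * lam2))) :
    (1 + σ) * (c / 2 * ⟪z, Ls z⟫ + 4 * c * ‖u‖ ^ 2) ≤
      c / 2 * ⟪z - p, Ls (z - p)⟫ + 4 * c * ‖u₀‖ ^ 2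
      + (2 * c * β * lamn + (c * β⁻¹ + 4 * σ * c) * lamn ^ 2 / (2 * lam2)) * ‖e'‖ ^ 2
      + (c * lamn / 2 + (c * β⁻¹ + 4 * σ * c) * lamn ^ 2 / (2 * lam2)) * ‖e‖ ^ 2
      - (c * lh1 / 2 - (1 / β + 4 * σ) * ((c ^ 2 * lhn ^ 2 + 4 * ℓ ^ 2) / (c * lam2))
        - ℓ ^ 2 / (v - σ * (c * lhn / 2) - (1 / β + 4 * σ) * (ℓ ^ 2 / (2 * c * lam2))))
        * ‖p‖ ^ 2 := by
  have hMin : ∀ a b, ⟪M a, M b⟫ = 2 * ⟪a, L b⟫ := fun a b => by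
    rw [real_inner_comm, ← hadj, hMM, inner_smul_left, real_inner_comm]
    simp
  -- testing the optimality equation against `z`
  have h1 : ⟪q, z⟫ + ⟪g, z⟫ + c * ⟪p, Ls z⟫ + c * ⟪e, L z⟫ - c * ⟪e', L z⟫
      + 2 * c * ⟪u, M z⟫ = 0 := by
    have := congrArg (fun t => ⟪t, z⟫) heq
    simpa only [inner_add_left, inner_sub_left, real_inner_smul_left, inner_zero_left, hadj, hLsym,
      hLssym] using this
  have hM1 : ⟪u, M z⟫ = 4 * ⟪u, u - u₀⟫ - ⟪u, M e'⟫ := by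
    have : u - u₀ = (4 : ℝ)⁻¹ • M (z + e') := by rw [hr]; abel
    rw [this, map_add, real_inner_smul_right, inner_add_right]; ring
  have hM2 : 8 * ‖u - u₀‖ ^ 2 = ⟪z, L z⟫ + 2 * ⟪e', L z⟫ + ⟪e', L e'⟫ := by
    have : u - u₀ = (4 : ℝ)⁻¹ • M (z + e') := by rw [hr]; abel
    rw [this, norm_smul_sq, ← real_inner_self_eq_norm_sq, hMin]
    simp only [map_add, inner_add_left, inner_add_right]
    rw [show ⟪z, L e'⟫ = ⟪e', L z⟫ by rw [← hLsym, real_inner_comm]]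
    norm_num; ring
  have hu0 : ‖u₀‖ ^ 2 = ‖u‖ ^ 2 - 2 * ⟪u, u - u₀⟫ + ‖u - u₀‖ ^ 2 := by
    rw [← norm_sub_sq_real, sub_sub_cancel]
  have hzp : ⟪z - p, Ls (z - p)⟫ = ⟪z, Ls z⟫ - 2 * ⟪p, Ls z⟫ + ⟪p, Ls p⟫ := by
    simp only [map_sub, inner_sub_left, inner_sub_right]
    rw [show ⟪z, Ls p⟫ = ⟪p, Ls z⟫ by rw [← hLssym, real_inner_comm]]
    ring
  have hez : 0 ≤ ⟪z, L z⟫ + 2 * ⟪e, L z⟫ + ⟪e, L e⟫ := by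
    have := hL0 (z + e)
    simp only [map_add, inner_add_left, inner_add_right] at this
    rw [show ⟪z, L e⟫ = ⟪e, L z⟫ by rw [← hLsym, real_inner_comm]] at this
    linarith
  -- Young inequality for the dual error term
  have hyoung : 2 * ⟪u, M e'⟫ ≤ 1 / β * ‖u‖ ^ 2 + 2 * β * ⟪e', L e'⟫ := by
    have h := sq_nonneg ‖u - β • M e'‖
    rw [norm_sub_sq_real, real_inner_smul_right, norm_smul_sq,
      ← real_inner_self_eq_norm_sq (M e'), hMin] at h
    have h3 : 2 * ⟪u, M e'⟫ * β ≤ (1 / β * ‖u‖ ^ 2 + 2 * β * ⟪e', L e'⟫) * β := by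
      have : 1 / β * ‖u‖ ^ 2 * β = ‖u‖ ^ 2 := by field_simp
      rw [add_mul, this]
      linarith
    exact le_of_mul_le_mul_right h3 hβ
  have hU : c * ‖u‖ ^ 2 ≤ (ℓ ^ 2 / (2 * c * lam2)) * ‖z‖ ^ 2
      + (c ^ 2 * lhn ^ 2 + 4 * ℓ ^ 2) / (c * lam2) * ‖p‖ ^ 2
      + c * lamn ^ 2 / (2 * lam2) * (‖e‖ ^ 2 + ‖e'‖ ^ 2) := by
    have h3 : (2 * c) • Mt u = -(q + g + c • Ls p + c • L e + -(c • L e')) := by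
      rw [eq_neg_iff_add_eq_zero, ← heq]; abel
    have h4 : (2 * c) ^ 2 * ‖Mt u‖ ^ 2 ≤ 4 * (ℓ ^ 2 * ‖z‖ ^ 2) + 8 * (4 * ℓ ^ 2 * ‖p‖ ^ 2)
        + 8 * (c ^ 2 * (lhn ^ 2 * ‖p‖ ^ 2)) + 4 * (c ^ 2 * (lamn ^ 2 * ‖e‖ ^ 2))
        + 4 * (c ^ 2 * (lamn ^ 2 * ‖e'‖ ^ 2)) := by
      rw [← norm_smul_sq, h3, norm_neg]
      refine (norm_sq_add_five_le _ _ _ _ _).trans ?_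
      simp only [norm_neg, norm_smul_sq c]
      gcongr
      exacts [hLs2 p, hL2 e, hL2 e']
    have h7 : (2 * c) ^ 2 * (2 * lam2 * ‖u‖ ^ 2) ≤ (2 * c) ^ 2 * ‖Mt u‖ ^ 2 := by gcongr
    have h8 := h7.trans h4
    have h9 : (c * ‖u‖ ^ 2) * (8 * c * lam2) ≤ ((ℓ ^ 2 / (2 * c * lam2)) * ‖z‖ ^ 2
      + (c ^ 2 * lhn ^ 2 + 4 * ℓ ^ 2) / (c * lam2) * ‖p‖ ^ 2
      + c * lamn ^ 2 / (2 * lam2) * (‖e‖ ^ 2 + ‖e'‖ ^ 2)) * (8 * c * lam2) := by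
      have : ((ℓ ^ 2 / (2 * c * lam2)) * ‖z‖ ^ 2
        + (c ^ 2 * lhn ^ 2 + 4 * ℓ ^ 2) / (c * lam2) * ‖p‖ ^ 2
        + c * lamn ^ 2 / (2 * lam2) * (‖e‖ ^ 2 + ‖e'‖ ^ 2)) * (8 * c * lam2)
        = 4 * ℓ ^ 2 * ‖z‖ ^ 2 + 8 * (c ^ 2 * lhn ^ 2 + 4 * ℓ ^ 2) * ‖p‖ ^ 2
          + 4 * c ^ 2 * lamn ^ 2 * (‖e‖ ^ 2 + ‖e'‖ ^ 2) := by
        field_simp; ring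
      rw [this]; linarith
    exact le_of_mul_le_mul_right h9 (by positivity)
  have hU' := mul_le_mul_of_nonneg_left hU (show 0 ≤ 1 / β + 4 * σ by positivity)
  set α := v - σ * (c * lhn / 2) - (1 / β + 4 * σ) * (ℓ ^ 2 / (2 * c * lam2)) with hα
  have hgz : -⟪g, z⟫ ≤ α * ‖z‖ ^ 2 + ℓ ^ 2 / α * ‖p‖ ^ 2 := by
    have h := sq_nonneg ‖g + (2 * α) • z‖
    rw [norm_add_sq_real, real_inner_smul_right, norm_smul_sq] at h
    have h3 : -⟪g, z⟫ * (4 * α) ≤ (α * ‖z‖ ^ 2 + ℓ ^ 2 / α * ‖p‖ ^ 2) * (4 * α) := by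
      have : ℓ ^ 2 / α * ‖p‖ ^ 2 * (4 * α) = 4 * ℓ ^ 2 * ‖p‖ ^ 2 := by field_simp
      rw [add_mul, this]
      linarith
    exact le_of_mul_le_mul_right h3 (by positivity)
  have hzs := mul_le_mul_of_nonneg_left (hLs1 z) (show 0 ≤ σ * (c / 2) by positivity)
  have hps := mul_le_mul_of_nonneg_left (hLs0 p) (show 0 ≤ c / 2 by positivity)
  have hee := mul_le_mul_of_nonneg_left (hL1 e) (show 0 ≤ c / 2 by positivity)
  have hee' := mul_le_mul_of_nonneg_left (hL1 e') (show 0 ≤ 2 * c * β by positivity)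
  have hcy := mul_le_mul_of_nonneg_left hyoung hc.le
  have hcez := mul_nonneg (show 0 ≤ c / 2 by positivity) hez
  have hce' := mul_nonneg (show 0 ≤ c / 2 by positivity) (hL0 e')
  rw [hzp, hu0]
  have hM2c : c / 2 * (8 * ‖u - u₀‖ ^ 2) = c / 2 * (⟪z, L z⟫ + 2 * ⟪e', L z⟫ + ⟪e', L e'⟫) := by
    rw [hM2]
  have e1 : (c * β⁻¹ + 4 * σ * c) * lamn ^ 2 / (2 * lam2)
      = (1 / β + 4 * σ) * (c * lamn ^ 2 / (2 * lam2)) := by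
    rw [one_div]; ring
  rw [e1]
  rw [hM1] at h1
  have hαz : α * ‖z‖ ^ 2 = v * ‖z‖ ^ 2 - σ * (c * lhn / 2) * ‖z‖ ^ 2
    - (1 / β + 4 * σ) * (ℓ ^ 2 / (2 * c * lam2)) * ‖z‖ ^ 2 := by rw [hα]; ring
  generalize ℓ ^ 2 / α = t1 at *
  generalize ℓ ^ 2 / (2 * c * lam2) = t2 at *
  generalize (c ^ 2 * lhn ^ 2 + 4 * ℓ ^ 2) / (c * lam2) = t3 at *
  generalize c * lamn ^ 2 / (2 * lam2) = t4 at *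
  generalize 1 / β = t5 at *
  linarith

theorem exists_contraction_parameters {c β v ℓ lam2 lamn lh1 lhn δ : ℝ} (hc : 0 < c)
    (hlam2 : 0 < lam2) (hlamn : 0 < lamn) (hv : 0 < v) (hδ1 : δ < 1)
    (hβ : ℓ ^ 2 / (2 * c * lam2 * v) < β)
    (hδ : δ / (1 - Real.sqrt δ) ^ 2 <
      (c * lh1 / 2 - 4 * ℓ ^ 2 * c * β * lam2 / (4 * c * β * lam2 * v - 2 * ℓ ^ 2)
        - (c ^ 2 * lhn ^ 2 + 4 * ℓ ^ 2) / (c * β * lam2)) /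
      (3 * c * lamn + 2 * c * β * lamn + c * lamn ^ 2 / (β * lam2))) :
    ∃ w σ : ℝ, 0 < w ∧ 0 < σ ∧
      0 < v - σ * (c * lhn / 2) - (1 / β + 4 * σ) * (ℓ ^ 2 / (2 * c * lam2)) ∧
      3 * c * lamn / 2 + (c * β⁻¹ + 4 * σ * c) * lamn ^ 2 / (2 * lam2)
        + ((1 + σ) * w + (3 * c * lamn / 2 + 2 * c * β * lamn
          + (c * β⁻¹ + 4 * σ * c) * lamn ^ 2 / (2 * lam2))) * Real.sqrt δ ≤ w ∧
      ((1 + σ) * w + (3 * c * lamn / 2 + 2 * c * β * lamn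
          + (c * β⁻¹ + 4 * σ * c) * lamn ^ 2 / (2 * lam2))) * (δ / (1 - Real.sqrt δ)) ≤
        c * lh1 / 2 - (1 / β + 4 * σ) * ((c ^ 2 * lhn ^ 2 + 4 * ℓ ^ 2) / (c * lam2))
        - ℓ ^ 2 / (v - σ * (c * lhn / 2) - (1 / β + 4 * σ) * (ℓ ^ 2 / (2 * c * lam2))) := by
  have hβ0 : 0 < β := lt_of_le_of_lt (by positivity) hβ
  have hs1 : Real.sqrt δ < 1 := by rw [Real.sqrt_lt' one_pos]; simpa using hδ1
  have hs0 := Real.sqrt_nonneg δ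
  set s := Real.sqrt δ
  let α : ℝ → ℝ := fun σ => v - σ * (c * lhn / 2) - (1 / β + 4 * σ) * (ℓ ^ 2 / (2 * c * lam2))
  let A : ℝ → ℝ := fun σ => 3 * c * lamn / 2 + 2 * c * β * lamn
          + (c * β⁻¹ + 4 * σ * c) * lamn ^ 2 / (2 * lam2)
  let B : ℝ → ℝ := fun σ => 3 * c * lamn / 2 + (c * β⁻¹ + 4 * σ * c) * lamn ^ 2 / (2 * lam2)
  let w : ℝ → ℝ := fun σ => (B σ + A σ * s) / (1 - (1 + σ) * s)
  let K : ℝ → ℝ := fun σ =>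
    c * lh1 / 2 - (1 / β + 4 * σ) * ((c ^ 2 * lhn ^ 2 + 4 * ℓ ^ 2) / (c * lam2)) - ℓ ^ 2 / α σ
  have hα0 : α 0 = v - ℓ ^ 2 / (2 * c * β * lam2) := by simp only [α]; field_simp; ring
  have hαpos : 0 < α 0 := by
    rw [hα0, sub_pos, div_lt_iff₀ (by positivity)]
    rw [div_lt_iff₀ (by positivity)] at hβ
    linarith
  have hαc : ContinuousAt α 0 := by fun_prop
  have hAc : ContinuousAt A 0 := by fun_prop
  have hBc : ContinuousAt B 0 := by fun_prop
  have hdc : ContinuousAt (fun σ : ℝ => 1 - (1 + σ) * s) 0 := by fun_prop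
  have hwc : ContinuousAt w 0 :=
    ContinuousAt.div (by fun_prop) hdc (by simp only [add_zero, one_mul]; linarith)
  have hKc : ContinuousAt K 0 :=
    ContinuousAt.sub (by fun_prop) (ContinuousAt.div (by fun_prop) hαc hαpos.ne')
  have hF : ((1 + (0 : ℝ)) * w 0 + A 0) * (δ / (1 - s)) < K 0 := by
    have hD : 0 < 3 * c * lamn + 2 * c * β * lamn + c * lamn ^ 2 / (β * lam2) := by positivity
    rw [lt_div_iff₀ hD] at hδ
    have hAB : A 0 + B 0 = 3 * c * lamn + 2 * c * β * lamn + c * lamn ^ 2 / (β * lam2) := by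
      simp only [A, B]; field_simp; ring
    have hK : K 0 = c * lh1 / 2 - 4 * ℓ ^ 2 * c * β * lam2 / (4 * c * β * lam2 * v - 2 * ℓ ^ 2)
        - (c ^ 2 * lhn ^ 2 + 4 * ℓ ^ 2) / (c * β * lam2) := by
      have h1 : ℓ ^ 2 / α 0 = 4 * ℓ ^ 2 * c * β * lam2 / (4 * c * β * lam2 * v - 2 * ℓ ^ 2) := by
        have h2 : 4 * c * β * lam2 * v - 2 * ℓ ^ 2 = 4 * c * β * lam2 * α 0 := by
          rw [hα0]; field_simp; ring
        rw [h2]; field_simp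
      have h3 : (1 / β + 4 * 0) * ((c ^ 2 * lhn ^ 2 + 4 * ℓ ^ 2) / (c * lam2))
          = (c ^ 2 * lhn ^ 2 + 4 * ℓ ^ 2) / (c * β * lam2) := by field_simp; ring
      simp only [K]
      rw [h1, h3]; ring
    have h4 : ((1 + (0 : ℝ)) * w 0 + A 0) * (δ / (1 - s)) = δ / (1 - s) ^ 2 * (A 0 + B 0) := by
      have : 1 - s ≠ 0 := by linarith
      simp only [w, add_zero, one_mul]
      field_simp; ring
    rw [h4, hK, hAB]; exact hδ
  have ev1 := hαc.eventually (lt_mem_nhds hαpos)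
  have ev2 := hdc.eventually (lt_mem_nhds (a := 0) (by simp only [add_zero, one_mul]; linarith))
  have hFc : ContinuousAt (fun σ : ℝ => ((1 + σ) * w σ + A σ) * (δ / (1 - s))) 0 := by fun_prop
  have ev3 := hFc.eventually_lt hKc hF
  obtain ⟨σ, ⟨h1, h2, h3⟩, hσ⟩ := (((ev1.and (ev2.and ev3)).filter_mono
    nhdsWithin_le_nhds).and (self_mem_nhdsWithin (s := Set.Ioi (0 : ℝ)))).exists
  have hσ : 0 < σ := hσ
  have hB : 0 < B σ := by simp only [B]; positivity
  have hA : 0 < A σ := by simp only [A]; positivity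
  refine ⟨w σ, σ, div_pos (by positivity) h2, hσ, h1, le_of_eq ?_, h3.le⟩
  have : w σ * (1 - (1 + σ) * s) = B σ + A σ * s := div_mul_cancel₀ _ h2.ne'
  simp only [A, B] at this
  linarith

theorem LinearMap.IsSymmetric.quadratic_nonneg {E : Type*} [NormedAddCommGroup E]
    [InnerProductSpace ℝ E] [FiniteDimensional ℝ E] {T : E →ₗ[ℝ] E} (hT : T.IsSymmetric)
    {p q s : ℝ} (h : ∀ t, Module.End.HasEigenvalue T t → 0 ≤ p + q * t + s * t ^ 2) (z : E) :
    0 ≤ p * ‖z‖ ^ 2 + q * ⟪z, T z⟫ + s * ‖T z‖ ^ 2 := by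
  let b := hT.eigenvectorBasis rfl
  have hb : ∀ i, ⟪b i, T z⟫ = hT.eigenvalues rfl i * ⟪b i, z⟫ := fun i => by
    rw [← hT, hT.apply_eigenvectorBasis rfl i, real_inner_smul_left]; rfl
  have h1 : p * ‖z‖ ^ 2 + q * ⟪z, T z⟫ + s * ‖T z‖ ^ 2 =
      ∑ i, (p + q * hT.eigenvalues rfl i + s * hT.eigenvalues rfl i ^ 2) * ⟪b i, z⟫ ^ 2 := by
    rw [← real_inner_self_eq_norm_sq, ← real_inner_self_eq_norm_sq, ← b.sum_inner_mul_inner z z,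
      ← b.sum_inner_mul_inner z (T z), ← b.sum_inner_mul_inner (T z) (T z), Finset.mul_sum,
      Finset.mul_sum, Finset.mul_sum, ← Finset.sum_add_distrib, ← Finset.sum_add_distrib]
    refine Finset.sum_congr rfl fun i _ => ?_
    rw [real_inner_comm (b i) z, real_inner_comm (b i) (T z), hb]
    ring
  rw [h1]
  exact Finset.sum_nonneg fun i _ =>
    mul_nonneg (h _ (hT.hasEigenvalue_eigenvalues rfl i)) (sq_nonneg _)

/-- Stacked vectors `ℝ^{nd}`, with their Euclidean structure. -/
abbrev Stack (n d : ℕ) := PiLp 2 (fun _ : Fin n => EuclideanSpace ℝ (Fin d))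

/-- The operator `A ⊗ I_d` on stacked vectors. -/
def blockLin {m n : ℕ} (d : ℕ) (A : Matrix (Fin m) (Fin n) ℝ) : Stack n d →ₗ[ℝ] Stack m d where
  toFun z := WithLp.toLp 2 (blockMul A z)
  map_add' a b := by ext i; simp [blockMul, Finset.sum_add_distrib]
  map_smul' t a := by
    ext i; simp [blockMul, Finset.mul_sum, mul_left_comm]

section Block

variable {m n d : ℕ}

theorem blockLin_apply (A : Matrix (Fin m) (Fin n) ℝ) (z : Stack n d) (i : Fin m) :
    blockLin d A z i = ∑ j, A i j • z j := rfl

theorem inner_blockLin_transpose (A : Matrix (Fin m) (Fin n) ℝ) (u : Stack m d) (z : Stack n d) :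
    ⟪blockLin d Aᵀ u, z⟫ = ⟪u, blockLin d A z⟫ := by
  rw [PiLp.inner_apply, PiLp.inner_apply]
  simp only [blockLin_apply, sum_inner, inner_sum, real_inner_smul_left,
    real_inner_smul_right, Matrix.transpose_apply]
  exact Finset.sum_comm

theorem blockLin_mul {l : ℕ} (A : Matrix (Fin l) (Fin m) ℝ) (B : Matrix (Fin m) (Fin n) ℝ)
    (z : Stack n d) : blockLin d (A * B) z = blockLin d A (blockLin d B z) := by
  refine PiLp.ext fun i => ?_
  simp only [blockLin_apply, Matrix.mul_apply, Finset.sum_smul, Finset.smul_sum, smul_smul]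
  exact Finset.sum_comm

theorem blockLin_smul (t : ℝ) (A : Matrix (Fin m) (Fin n) ℝ) (z : Stack n d) :
    blockLin d (t • A) z = t • blockLin d A z := by
  refine PiLp.ext fun i => ?_
  simp only [blockLin_apply, PiLp.smul_apply, Matrix.smul_apply, Finset.smul_sum, smul_smul,
    smul_eq_mul]

theorem blockLin_isSymmetric {A : Matrix (Fin n) (Fin n) ℝ} (hA : Aᵀ = A) :
    (blockLin d A).IsSymmetric := fun a b => by
  conv_lhs => rw [← hA]
  exact inner_blockLin_transpose A a b

theorem isEigenvalue_of_blockLin {A : Matrix (Fin n) (Fin n) ℝ} {t : ℝ}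
    (h : Module.End.HasEigenvalue (blockLin d A) t) : IsEigenvalue A t := by
  obtain ⟨z, hz⟩ := h.exists_hasEigenvector
  have hz0 := hz.2
  have hze := hz.apply_eq_smul
  obtain ⟨l, hl⟩ : ∃ l, (fun i => z i l) ≠ 0 := by
    by_contra! hcon
    exact hz0 (PiLp.ext fun i => PiLp.ext fun l => congrFun (hcon l) i)
  refine ⟨fun i => z i l, hl, funext fun i => ?_⟩
  have := congrArg (fun x : Stack n d => x i l) hze
  simpa [blockLin_apply, Matrix.mulVec, dotProduct] using this

theorem blockLin_quadratic_nonneg {A : Matrix (Fin n) (Fin n) ℝ} (hA : Aᵀ = A) {p q s : ℝ}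
    (h : ∀ t, IsEigenvalue A t → 0 ≤ p + q * t + s * t ^ 2) (z : Stack n d) :
    0 ≤ p * ‖z‖ ^ 2 + q * ⟪z, blockLin d A z⟫ + s * ‖blockLin d A z‖ ^ 2 :=
  (blockLin_isSymmetric hA).quadratic_nonneg (fun t ht => h t (isEigenvalue_of_blockLin ht)) z

end Block

theorem IsEigenvalue.nonneg {n : ℕ} {A : Matrix (Fin n) (Fin n) ℝ} (hA : A.PosSemidef) {t : ℝ}
    (ht : IsEigenvalue A t) : 0 ≤ t := by
  obtain ⟨z, hz, h⟩ := ht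
  have h1 := hA.dotProduct_mulVec_nonneg z
  rw [h, dotProduct_smul, smul_eq_mul] at h1
  have h2 : 0 < star z ⬝ᵥ z := by
    exact Matrix.dotProduct_star_self_pos_iff.2 hz
  exact nonneg_of_mul_nonneg_left h1 h2

section Gradient

variable {E : Type*} [NormedAddCommGroup E] [InnerProductSpace ℝ E] [CompleteSpace E]
  {f : E → ℝ}

theorem differentiable_gradient_of_contDiff_two (hf : ContDiff ℝ 2 f) :
    Differentiable ℝ (gradient f) := by
  have h : Differentiable ℝ (fderiv ℝ f) :=
    (hf.fderiv_right (m := 1) (by norm_num)).differentiable (by norm_num)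
  exact (InnerProductSpace.toDual ℝ E).symm.toContinuousLinearEquiv.differentiable.comp h

theorem inner_fderiv_gradient_ge (hf : ContDiff ℝ 2 f) {v : ℝ}
    (hsc : ∀ x x', v * ‖x' - x‖ ^ 2 ≤ ⟪gradient f x' - gradient f x, x' - x⟫) (y u : E) :
    v * ‖u‖ ^ 2 ≤ ⟪fderiv ℝ (gradient f) y u, u⟫ := by
  have hd := ((differentiable_gradient_of_contDiff_two hf) y).hasFDerivAt.hasLineDerivAt u
  have hs := hd.tendsto_slope_zero_right
  have hi : Filter.Tendsto
      (fun t : ℝ => ⟪t⁻¹ • (gradient f (y + t • u) - gradient f y), u⟫)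
      (nhdsWithin 0 (Set.Ioi 0)) (nhds ⟪fderiv ℝ (gradient f) y u, u⟫) :=
    Filter.Tendsto.inner (by simpa using hs) tendsto_const_nhds
  refine ge_of_tendsto hi ?_
  filter_upwards [self_mem_nhdsWithin] with t ht
  have ht : 0 < t := ht
  have := hsc y (y + t • u)
  rw [add_sub_cancel_left, norm_smul_sq, real_inner_smul_right] at this
  rw [real_inner_smul_left, inv_mul_eq_div, le_div_iff₀ ht]
  exact le_of_mul_le_mul_left (by linarith) ht

theorem norm_fderiv_gradient_le {ℓ : ℝ}
    (hlip : ∀ x x', ‖gradient f x' - gradient f x‖ ≤ ℓ * ‖x' - x‖) (y u : E) :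
    ‖fderiv ℝ (gradient f) y u‖ ≤ ℓ * ‖u‖ := by
  rcases eq_or_ne u 0 with rfl | hu
  · simp
  have hℓ : 0 ≤ ℓ := by
    have := (norm_nonneg _).trans (hlip 0 u)
    rw [sub_zero] at this
    exact nonneg_of_mul_nonneg_left this (norm_pos_iff.2 hu)
  exact ContinuousLinearMap.le_of_opNorm_le _
    (norm_fderiv_le_of_lip' ℝ hℓ (Filter.Eventually.of_forall fun x => hlip y x)) u

theorem isUnit_smul_one_add_fderiv_gradient [FiniteDimensional ℝ E] (hf : ContDiff ℝ 2 f) {v t : ℝ}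
    (hv : 0 < v) (ht : 0 ≤ t)
    (hsc : ∀ x x', v * ‖x' - x‖ ^ 2 ≤ ⟪gradient f x' - gradient f x, x' - x⟫) (y : E) :
    IsUnit (t • (1 : E →L[ℝ] E) + fderiv ℝ (gradient f) y) := by
  rw [ContinuousLinearMap.isUnit_iff_bijective]
  set T := t • (1 : E →L[ℝ] E) + fderiv ℝ (gradient f) y
  have hinj : Function.Injective T := by
    rw [injective_iff_map_eq_zero]
    intro u hu
    have h1 := inner_fderiv_gradient_ge hf hsc y u
    have h2 : ⟪T u, u⟫ = t * ‖u‖ ^ 2 + ⟪fderiv ℝ (gradient f) y u, u⟫ := by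
      simp [T, inner_add_left, real_inner_smul_left]
    rw [hu, inner_zero_left] at h2
    have h3 : ‖u‖ ^ 2 ≤ 0 := by
      have := mul_nonneg ht (sq_nonneg ‖u‖)
      exact nonpos_of_mul_nonpos_right (show v * ‖u‖ ^ 2 ≤ 0 by linarith) hv
    simpa using h3
  exact ⟨hinj, (LinearMap.injective_iff_surjective (f := T.toLinearMap)).1 hinj⟩

end Gradient

theorem norm_sq_censored_error_le {E : Type*} [NormedAddCommGroup E] [InnerProductSpace ℝ E]
    {δ τ : ℝ} (hδ0 : 0 ≤ δ) (hδ1 : δ < 1) {C : E → E} (hC : ∀ z, ‖C z - z‖ ^ 2 ≤ δ * ‖z‖ ^ 2)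
    (x x' y : E) :
    ‖(if τ ≤ ‖x' - y‖ then y + C (x' - y) else y) - x'‖ ^ 2 ≤
      Real.sqrt δ * ‖y - x‖ ^ 2 + δ / (1 - Real.sqrt δ) * ‖x' - x‖ ^ 2 + τ ^ 2 := by
  have hs1 : Real.sqrt δ < 1 := by rw [Real.sqrt_lt' one_pos]; simpa using hδ1
  have hs0 := Real.sqrt_nonneg δ
  have hss := Real.sq_sqrt hδ0
  set s := Real.sqrt δ
  rw [← hss]
  have h1s : 0 < 1 - s := by linarith
  split_ifs with h
  · have h1 : ‖y + C (x' - y) - x'‖ ^ 2 ≤ s ^ 2 * ‖x' - y‖ ^ 2 := by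
      rw [hss, show y + C (x' - y) - x' = C (x' - y) - (x' - y) by abel]
      exact hC _
    have h2 : x' - y = (x' - x) - (y - x) := by abel
    have h3 := sq_nonneg ‖s • (x' - x) + (1 - s) • (y - x)‖
    rw [norm_add_sq_real, norm_smul_sq, norm_smul_sq, real_inner_smul_left,
      real_inner_smul_right] at h3
    have h4 : s ^ 2 * (‖x' - x‖ ^ 2 - 2 * ⟪x' - x, y - x⟫ + ‖y - x‖ ^ 2) ≤
        s * ‖y - x‖ ^ 2 + s ^ 2 / (1 - s) * ‖x' - x‖ ^ 2 := by
      refine le_of_mul_le_mul_right ?_ h1s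
      have h5 : s ^ 2 / (1 - s) * ‖x' - x‖ ^ 2 * (1 - s) = s ^ 2 * ‖x' - x‖ ^ 2 := by
        field_simp
      rw [add_mul _ _ (1 - s), h5]
      have h6 := mul_nonneg hs0 h3
      linarith
    rw [← norm_sub_sq_real, ← h2] at h4
    linarith [sq_nonneg τ]
  · have h1 : ‖y - x'‖ ^ 2 ≤ τ ^ 2 := by
      rw [norm_sub_rev]
      exact pow_le_pow_left₀ (norm_nonneg _) (not_le.1 h).le 2
    have : 0 ≤ s * ‖y - x‖ ^ 2 + s ^ 2 / (1 - s) * ‖x' - x‖ ^ 2 := by positivity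
    linarith

theorem lyap_eq {n m d : ℕ} (A : Matrix (Fin n) (Fin n) ℝ) (c w : ℝ)
    (xk ek : Fin n → EuclideanSpace ℝ (Fin d)) (rk : Fin m → EuclideanSpace ℝ (Fin d))
    (xstar : EuclideanSpace ℝ (Fin d)) (rstar : Fin m → EuclideanSpace ℝ (Fin d)) :
    lyap A c w xk ek rk xstar rstar =
      c / 2 * ⟪(WithLp.toLp 2 xk - WithLp.toLp 2 (fun _ => xstar) : Stack n d),
        blockLin d A (WithLp.toLp 2 xk - WithLp.toLp 2 (fun _ => xstar))⟫
      + 4 * c * ‖(WithLp.toLp 2 rk - WithLp.toLp 2 rstar : Stack m d)‖ ^ 2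
      + w * ‖(WithLp.toLp 2 ek : Stack n d)‖ ^ 2 := by
  rw [PiLp.norm_sq_eq_of_L2, PiLp.norm_sq_eq_of_L2, PiLp.inner_apply]
  rfl

section Graph

variable {n d : ℕ} (G : SimpleGraph (Fin n)) [DecidableRel G.Adj]

theorem signedLap_transpose : (signedLap G)ᵀ = signedLap G := G.isSymm_lapMatrix (R := ℝ)

theorem unsignedLap_transpose : (unsignedLap G)ᵀ = unsignedLap G := by
  simp [unsignedLap]

theorem blockLin_diagonal_apply (a : Fin n → ℝ) (z : Stack n d) (i : Fin n) :
    blockLin d (Matrix.diagonal a) z i = a i • z i := by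
  simp [blockLin_apply, Matrix.diagonal_apply, ite_smul]

theorem blockLin_adjMatrix_apply (z : Stack n d) (i : Fin n) :
    blockLin d (G.adjMatrix ℝ) z i = ∑ j ∈ G.neighborFinset i, z j := by
  simp [blockLin_apply, SimpleGraph.adjMatrix_apply, ite_smul, SimpleGraph.neighborFinset_eq_filter,
    Finset.sum_filter]

theorem blockLin_signedLap_apply (z : Stack n d) (i : Fin n) :
    blockLin d (signedLap G) z i = ∑ j ∈ G.neighborFinset i, (z i - z j) := by
  have h : blockLin d (signedLap G) z i =
      blockLin d (Matrix.diagonal fun i => (G.degree i : ℝ)) z i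
        - blockLin d (G.adjMatrix ℝ) z i := by
    simp only [blockLin_apply, signedLap, Matrix.sub_apply, sub_smul, Finset.sum_sub_distrib]
  rw [h, blockLin_diagonal_apply, blockLin_adjMatrix_apply, Finset.sum_sub_distrib,
    Finset.sum_const, SimpleGraph.card_neighborFinset_eq_degree, Nat.cast_smul_eq_nsmul]

theorem two_degree_smul (z : Stack n d) (i : Fin n) :
    (2 * (G.degree i : ℝ)) • z i =
      blockLin d (signedLap G) z i + blockLin d (unsignedLap G) z i := by
  have h : blockLin d (signedLap G) z i + blockLin d (unsignedLap G) z i =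
      (2 : ℝ) • blockLin d (Matrix.diagonal fun i => (G.degree i : ℝ)) z i := by
    simp only [blockLin_apply, signedLap, unsignedLap, Matrix.sub_apply, Matrix.add_apply,
      Finset.smul_sum, ← Finset.sum_add_distrib]
    exact Finset.sum_congr rfl fun j _ => by module
  rw [h, blockLin_diagonal_apply, smul_smul]

end Graph

theorem ring_inverse_apply_cancel {E : Type*} [NormedAddCommGroup E] [NormedSpace ℝ E] {T : E →L[ℝ] E}
    (hT : IsUnit T) (a : E) : T (Ring.inverse T a) = a := by
  rw [← mul_apply_eq_comp, Ring.mul_inverse_cancel _ hT,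
    one_apply_eq_self]

/-- **Key Lyapunov contraction lemma for CC-DQM** (Lemma 3). Under the parameter
condition there exist `w > 0` and `σ̂ > 0` such that the Lyapunov sequence satisfies
`V_{k+1} ≤ V_k/(1+σ̂) + n ψ μ_{k+1}²`. -/
theorem ccdqm_lyapunov_contraction
    {n m d : ℕ} (G : SimpleGraph (Fin n)) [DecidableRel G.Adj] (hconn : G.Connected)
    (f : Fin n → EuclideanSpace ℝ (Fin d) → ℝ)
    (vi li : Fin n → ℝ) (v ℓ : ℝ)
    (hf : ∀ i, ContDiff ℝ 2 (f i))
    (hvi : ∀ i, 0 < vi i)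
    (hsc : ∀ i x x', vi i * ‖x' - x‖ ^ 2 ≤ ⟪gradient (f i) x' - gradient (f i) x, x' - x⟫)
    (hlip : ∀ i x x', ‖gradient (f i) x' - gradient (f i) x‖ ≤ li i * ‖x' - x‖)
    (hv : IsLeast (Set.range vi) v) (hℓ : IsGreatest (Set.range li) ℓ)
    (lam2 lamn lh1 lhn : ℝ)
    (hlam2 : IsEigenvalue (signedLap G) lam2 ∧ 0 < lam2 ∧
      ∀ t, IsEigenvalue (signedLap G) t → 0 < t → lam2 ≤ t)
    (hlamn : IsEigenvalue (signedLap G) lamn ∧ ∀ t, IsEigenvalue (signedLap G) t → t ≤ lamn)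
    (hlh1 : IsEigenvalue (unsignedLap G) lh1 ∧ ∀ t, IsEigenvalue (unsignedLap G) t → lh1 ≤ t)
    (hlhn : IsEigenvalue (unsignedLap G) lhn ∧ ∀ t, IsEigenvalue (unsignedLap G) t → t ≤ lhn)
    (hposdef : (unsignedLap G).PosDef)
    (c δ : ℝ) (hc : 0 < c) (hδ0 : 0 ≤ δ) (hδ1 : δ < 1)
    (C : EuclideanSpace ℝ (Fin d) → EuclideanSpace ℝ (Fin d))
    (hC : ∀ z, ‖C z - z‖ ^ 2 ≤ δ * ‖z‖ ^ 2)
    (μ : ℕ → ℝ) (hμ : ∀ k, 0 ≤ μ k)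
    (x y φ : ℕ → Fin n → EuclideanSpace ℝ (Fin d))
    (halg : IsCCDQM G f c μ C x y φ)
    (xstar : EuclideanSpace ℝ (Fin d))
    (hxstar : ∀ z, ∑ i, f i xstar ≤ ∑ i, f i z)
    (M : Matrix (Fin m) (Fin n) ℝ) (hM : Mᵀ * M = (2 : ℝ) • signedLap G)
    (r : ℕ → Fin m → EuclideanSpace ℝ (Fin d))
    (hr0 : ∀ j, r 0 j = 0)
    (hr : ∀ k j, r (k+1) j = r k j + (4 : ℝ)⁻¹ • blockMul M (y (k+1)) j)
    (rstar : Fin m → EuclideanSpace ℝ (Fin d))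
    (hrstar_range : ∃ z : Fin n → EuclideanSpace ℝ (Fin d), rstar = blockMul M z)
    (hrstar : ∀ i, (2 * c) • blockMul Mᵀ rstar i = -(gradient (f i) xstar))
    (β : ℝ)
    (hβ : ℓ ^ 2 / (2 * c * lam2 * v) < β)
    (hG : 0 < c * lh1 / 2 - 4 * ℓ ^ 2 * c * β * lam2 / (4 * c * β * lam2 * v - 2 * ℓ ^ 2)
        - (c ^ 2 * lhn ^ 2 + 4 * ℓ ^ 2) / (c * β * lam2))
    (hδcond : δ / (1 - Real.sqrt δ) ^ 2 <
      (c * lh1 / 2 - 4 * ℓ ^ 2 * c * β * lam2 / (4 * c * β * lam2 * v - 2 * ℓ ^ 2)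
        - (c ^ 2 * lhn ^ 2 + 4 * ℓ ^ 2) / (c * β * lam2)) /
      (3 * c * lamn + 2 * c * β * lamn + c * lamn ^ 2 / (β * lam2))) :
    ∃ w σh : ℝ, 0 < w ∧ 0 < σh ∧
      ∀ k : ℕ,
        lyap (unsignedLap G) c w (x (k+1)) (fun i => y (k+1) i - x (k+1) i) (r (k+1)) xstar rstar
          ≤ lyap (unsignedLap G) c w (x k) (fun i => y k i - x k i) (r k) xstar rstar / (1 + σh)
            + n * (w + 1 / (1 + σh) *
                (3 * c * lamn / 2 + 2 * c * β * lamn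
                  + (c * β⁻¹ + 4 * σh * c) * lamn ^ 2 / (2 * lam2)))
              * μ (k+1) ^ 2 := by
  classical
  obtain ⟨hy0, hφ0, hx, hy, hφ⟩ := halg
  obtain ⟨i₀, hi₀⟩ := hv.1
  have hvpos : 0 < v := hi₀ ▸ hvi i₀
  have hvle : ∀ i, v ≤ vi i := fun i => hv.2 ⟨i, rfl⟩
  have hlle : ∀ i, li i ≤ ℓ := fun i => hℓ.2 ⟨i, rfl⟩
  have hlamn0 : 0 < lamn := hlam2.2.1.trans_le (hlamn.2 _ hlam2.1)
  have hβ0 : 0 < β := lt_of_le_of_lt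
    (div_nonneg (sq_nonneg ℓ) (by have := hlam2.2.1; positivity)) hβ
  obtain ⟨w, σ, hw, hσ, hα, hwB, hwK⟩ :=
    exists_contraction_parameters hc hlam2.2.1 hlamn0 hvpos hδ1 hβ hδcond
  refine ⟨w, σ, hw, hσ, fun k => ?_⟩
  -- spectral bounds
  have hLsymm := signedLap_transpose G
  have hLssymm := unsignedLap_transpose G
  have hLpsd : (signedLap G).PosSemidef := G.posSemidef_lapMatrix ℝ
  have hL0 : ∀ a : Stack n d, 0 ≤ ⟪a, blockLin d (signedLap G) a⟫ := fun a => by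
    have := blockLin_quadratic_nonneg hLsymm (p := 0) (q := 1) (s := 0)
      (fun t ht => by simpa using ht.nonneg hLpsd) a
    linarith
  have hL1 : ∀ a : Stack n d, ⟪a, blockLin d (signedLap G) a⟫ ≤ lamn * ‖a‖ ^ 2 := fun a => by
    have := blockLin_quadratic_nonneg hLsymm (p := lamn) (q := -1) (s := 0)
      (fun t ht => by linarith [hlamn.2 t ht]) a
    linarith
  have hL2 : ∀ a : Stack n d, ‖blockLin d (signedLap G) a‖ ^ 2 ≤ lamn ^ 2 * ‖a‖ ^ 2 := fun a => by
    have := blockLin_quadratic_nonneg hLsymm (p := lamn ^ 2) (q := 0) (s := -1)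
      (fun t ht => by linarith [pow_le_pow_left₀ (ht.nonneg hLpsd) (hlamn.2 t ht) 2]) a
    linarith
  have hL3 : ∀ a : Stack n d, lam2 * ⟪a, blockLin d (signedLap G) a⟫ ≤
      ‖blockLin d (signedLap G) a‖ ^ 2 := fun a => by
    have := blockLin_quadratic_nonneg hLsymm (p := 0) (q := -lam2) (s := 1)
      (fun t ht => by
        rcases (ht.nonneg hLpsd).eq_or_lt with h | h
        · simp [← h]
        · linarith [mul_le_mul_of_nonneg_right (hlam2.2.2 t ht h) h.le]) a
    linarith
  have hLs0 : ∀ a : Stack n d, lh1 * ‖a‖ ^ 2 ≤ ⟪a, blockLin d (unsignedLap G) a⟫ := fun a => by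
    have := blockLin_quadratic_nonneg hLssymm (p := -lh1) (q := 1) (s := 0)
      (fun t ht => by linarith [hlh1.2 t ht]) a
    linarith
  have hLs1 : ∀ a : Stack n d, ⟪a, blockLin d (unsignedLap G) a⟫ ≤ lhn * ‖a‖ ^ 2 := fun a => by
    have := blockLin_quadratic_nonneg hLssymm (p := lhn) (q := -1) (s := 0)
      (fun t ht => by linarith [hlhn.2 t ht]) a
    linarith
  have hLs2 : ∀ a : Stack n d, ‖blockLin d (unsignedLap G) a‖ ^ 2 ≤ lhn ^ 2 * ‖a‖ ^ 2 := fun a => by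
    have := blockLin_quadratic_nonneg hLssymm (p := lhn ^ 2) (q := 0) (s := -1)
      (fun t ht => by
        linarith [pow_le_pow_left₀ (ht.nonneg hposdef.posSemidef) (hlhn.2 t ht) 2]) a
    linarith
  have hMM : ∀ a : Stack n d, blockLin d Mᵀ (blockLin d M a) =
      (2 : ℝ) • blockLin d (signedLap G) a := fun a => by
    rw [← blockLin_mul, hM, blockLin_smul]
  have hrange : ∀ a : Stack n d, 2 * lam2 * ‖blockLin d M a‖ ^ 2 ≤
      ‖blockLin d Mᵀ (blockLin d M a)‖ ^ 2 := fun a => by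
    rw [← real_inner_self_eq_norm_sq (blockLin d M a), ← inner_blockLin_transpose, hMM,
      norm_smul_sq, real_inner_smul_left, real_inner_comm]
    linarith [hL3 a]
  -- stacked iterates
  let X : ℕ → Stack n d := fun k => WithLp.toLp 2 (x k)
  let Y : ℕ → Stack n d := fun k => WithLp.toLp 2 (y k)
  let R : ℕ → Stack m d := fun k => WithLp.toLp 2 (r k)
  let Xs : Stack n d := WithLp.toLp 2 (fun _ => xstar)
  let Rs : Stack m d := WithLp.toLp 2 rstar
  have hRsucc : ∀ k, R (k + 1) = R k + (4 : ℝ)⁻¹ • blockLin d M (Y (k + 1)) := fun k =>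
    PiLp.ext fun j => hr k j
  have hMXs : blockLin d M Xs = 0 := by
    have hLXs : blockLin d (signedLap G) Xs = 0 := PiLp.ext fun i => by
      rw [blockLin_signedLap_apply]; simp [Xs]
    rw [← norm_eq_zero, ← sq_eq_zero_iff, ← real_inner_self_eq_norm_sq,
      ← inner_blockLin_transpose, hMM, hLXs, smul_zero, inner_zero_left]
  have hRrange : ∀ k, ∃ z : Stack n d, R k = blockLin d M z := fun k => by
    induction k with
    | zero => exact ⟨0, by rw [map_zero]; exact PiLp.ext hr0⟩
    | succ k ih =>
      obtain ⟨z, hz⟩ := ih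
      exact ⟨z + (4 : ℝ)⁻¹ • Y (k + 1), by rw [hRsucc, hz, map_add, map_smul]⟩
  have hMtR : ∀ k, (2 * c) • blockLin d Mᵀ (R (k + 1)) =
      (2 * c) • blockLin d Mᵀ (R k) + c • blockLin d (signedLap G) (Y (k + 1)) := fun k => by
    rw [hRsucc, map_add, map_smul, hMM]; module
  have hφR : ∀ k i, φ k i = (2 * c) • blockLin d Mᵀ (R k) i := fun k => by
    induction k with
    | zero =>
      intro i
      rw [hφ0, show R 0 = 0 from PiLp.ext hr0, map_zero]; simp
    | succ k ih =>
      intro i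
      have h := congrArg (fun t : Stack n d => t i) (hMtR k)
      simp only [PiLp.add_apply, PiLp.smul_apply] at h
      rw [hφ, ih, h, blockLin_signedLap_apply]
  have hu : 2 * lam2 * ‖R (k + 1) - Rs‖ ^ 2 ≤ ‖blockLin d Mᵀ (R (k + 1) - Rs)‖ ^ 2 := by
    obtain ⟨z, hz⟩ := hRrange (k + 1)
    obtain ⟨z', hz'⟩ := hrstar_range
    have : R (k + 1) - Rs = blockLin d M (z - WithLp.toLp 2 z') := by
      rw [hz, map_sub, show Rs = blockLin d M (WithLp.toLp 2 z') from PiLp.ext fun j => by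
        simp only [Rs, hz']; rfl]
    rw [this]
    exact hrange _
  let q : Stack n d := WithLp.toLp 2 fun i => gradient (f i) (x (k + 1) i) - gradient (f i) xstar
  let g : Stack n d := WithLp.toLp 2 fun i => gradient (f i) (x k i)
    + fderiv ℝ (gradient (f i)) (y k i) (x (k + 1) i - x k i) - gradient (f i) (x (k + 1) i)
  have heq : q + g + c • blockLin d (unsignedLap G) (X (k + 1) - X k)
      + c • blockLin d (signedLap G) (Y k - X k)
      - c • blockLin d (signedLap G) (Y (k + 1) - X (k + 1))
      + (2 * c) • blockLin d Mᵀ (R (k + 1) - Rs) = 0 := by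
    rw [map_sub (blockLin d Mᵀ), smul_sub, hMtR]
    refine PiLp.ext fun i => ?_
    have hunit := isUnit_smul_one_add_fderiv_gradient (hf i) (hvi i)
      (t := 2 * c * (G.degree i : ℝ)) (by positivity) (hsc i) (y k i)
    have h1 := hx k i
    rw [hφR, ← blockLin_signedLap_apply G (Y k) i] at h1
    have h2 := ring_inverse_apply_cancel hunit (gradient (f i) (x k i)
      + c • blockLin d (signedLap G) (Y k) i + (2 * c) • blockLin d Mᵀ (R k) i)
    rw [eq_sub_iff_add_eq, ← eq_sub_iff_add_eq', ← neg_sub] at h1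
    rw [h1] at h2
    have h3 := two_degree_smul G (X (k + 1) - X k) i
    have h4 : (2 * c) • blockLin d Mᵀ Rs i = -gradient (f i) xstar := hrstar i
    have h5 : (X (k + 1) - X k) i = x (k + 1) i - x k i := rfl
    rw [map_neg, _root_.add_apply, _root_.smul_apply,
      one_apply_eq_self, mul_right_comm, mul_comm _ c, mul_smul, ← h5, h3] at h2
    simp only [PiLp.add_apply, PiLp.sub_apply, PiLp.smul_apply, PiLp.zero_apply, q, g, h4,
      map_sub] at h2 ⊢
    rw [← sub_eq_zero] at h2
    rw [← neg_eq_zero, ← h2]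
    simp only [X]
    module
  have hrz : R (k + 1) - Rs = (R k - Rs)
      + (4 : ℝ)⁻¹ • blockLin d M ((X (k + 1) - Xs) + (Y (k + 1) - X (k + 1))) := by
    rw [hRsucc, sub_add_sub_comm, add_sub_add_comm]
    simp only [map_add, map_sub, hMXs]
    module
  have hq0 : v * ‖X (k + 1) - Xs‖ ^ 2 ≤ ⟪q, X (k + 1) - Xs⟫ := by
    rw [PiLp.norm_sq_eq_of_L2, PiLp.inner_apply, Finset.mul_sum]
    exact Finset.sum_le_sum fun i _ =>
      (mul_le_mul_of_nonneg_right (hvle i) (sq_nonneg _)).trans (hsc i xstar (x (k + 1) i))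
  have hlip' : ∀ i a b, ‖gradient (f i) b - gradient (f i) a‖ ≤ ℓ * ‖b - a‖ := fun i a b =>
    (hlip i a b).trans (mul_le_mul_of_nonneg_right (hlle i) (norm_nonneg _))
  have hq1 : ‖q‖ ^ 2 ≤ ℓ ^ 2 * ‖X (k + 1) - Xs‖ ^ 2 := by
    rw [PiLp.norm_sq_eq_of_L2, PiLp.norm_sq_eq_of_L2, Finset.mul_sum]
    refine Finset.sum_le_sum fun i _ => ?_
    rw [← mul_pow]
    exact pow_le_pow_left₀ (norm_nonneg _) (hlip' i _ _) 2
  have hg : ‖g‖ ^ 2 ≤ 4 * ℓ ^ 2 * ‖X (k + 1) - X k‖ ^ 2 := by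
    rw [PiLp.norm_sq_eq_of_L2, PiLp.norm_sq_eq_of_L2, Finset.mul_sum]
    refine Finset.sum_le_sum fun i _ => ?_
    rw [show 4 * ℓ ^ 2 = (2 * ℓ) ^ 2 by ring, ← mul_pow]
    refine pow_le_pow_left₀ (norm_nonneg _) ?_ 2
    have h1 := hlip' i (x (k + 1) i) (x k i)
    have h2 := norm_fderiv_gradient_le (hlip' i) (y k i) (x (k + 1) i - x k i)
    rw [norm_sub_rev (x k i)] at h1
    have h3 : g i = (gradient (f i) (x k i) - gradient (f i) (x (k + 1) i))
        + fderiv ℝ (gradient (f i)) (y k i) (x (k + 1) i - x k i) := by simp only [g]; abel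
    rw [h3]
    have h4 : (X (k + 1) - X k) i = x (k + 1) i - x k i := rfl
    rw [h4]
    exact (norm_add_le _ _).trans (by linarith)
  have hdesc := primal_dual_descent (blockLin d (signedLap G)) (blockLin d (unsignedLap G))
    (blockLin d M) (blockLin d Mᵀ) (inner_blockLin_transpose M) hMM
    (blockLin_isSymmetric hLsymm) (blockLin_isSymmetric hLssymm) hc hβ0 hσ hlam2.2.1
    hL0 hL1 hL2 hLs0 hLs1 hLs2 hu heq hrz hq0 hq1 hg hα
  have herr : ‖Y (k + 1) - X (k + 1)‖ ^ 2 ≤ Real.sqrt δ * ‖Y k - X k‖ ^ 2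
      + δ / (1 - Real.sqrt δ) * ‖X (k + 1) - X k‖ ^ 2 + n * μ (k + 1) ^ 2 := by
    have hn : (n : ℝ) * μ (k + 1) ^ 2 = ∑ _i : Fin n, μ (k + 1) ^ 2 := by simp
    rw [PiLp.norm_sq_eq_of_L2, PiLp.norm_sq_eq_of_L2, PiLp.norm_sq_eq_of_L2, hn, Finset.mul_sum,
      Finset.mul_sum, ← Finset.sum_add_distrib, ← Finset.sum_add_distrib]
    refine Finset.sum_le_sum fun i _ => ?_
    have := norm_sq_censored_error_le (τ := μ (k + 1)) hδ0 hδ1 hC (x k i) (x (k + 1) i) (y k i)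
    rw [← hy] at this
    exact this
  rw [lyap_eq, lyap_eq]
  change c / 2 * ⟪X (k + 1) - Xs, blockLin d (unsignedLap G) (X (k + 1) - Xs)⟫
      + 4 * c * ‖R (k + 1) - Rs‖ ^ 2 + w * ‖Y (k + 1) - X (k + 1)‖ ^ 2 ≤
    (c / 2 * ⟪X k - Xs, blockLin d (unsignedLap G) (X k - Xs)⟫
      + 4 * c * ‖R k - Rs‖ ^ 2 + w * ‖Y k - X k‖ ^ 2) / (1 + σ) + _
  rw [show X (k + 1) - Xs - (X (k + 1) - X k) = X k - Xs by abel] at hdesc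
  set A := 3 * c * lamn / 2 + 2 * c * β * lamn + (c * β⁻¹ + 4 * σ * c) * lamn ^ 2 / (2 * lam2)
    with hA
  have hA0 : 0 ≤ A := by have := hlam2.2.1; positivity
  have hQ := mul_le_mul_of_nonneg_left herr (show 0 ≤ (1 + σ) * w + A by positivity)
  have hwB' := mul_le_mul_of_nonneg_right hwB (sq_nonneg ‖Y k - X k‖)
  have hwK' := mul_le_mul_of_nonneg_right hwK (sq_nonneg ‖X (k + 1) - X k‖)
  have hslack := mul_nonneg (show 0 ≤ c * lamn by positivity) (sq_nonneg ‖Y k - X k‖)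
  have hslack' := mul_nonneg (show 0 ≤ c * lamn by positivity)
    (sq_nonneg ‖Y (k + 1) - X (k + 1)‖)
  have hAe : A * ‖Y (k + 1) - X (k + 1)‖ ^ 2 = 3 / 2 * (c * lamn * ‖Y (k + 1) - X (k + 1)‖ ^ 2)
      + (2 * c * β * lamn + (c * β⁻¹ + 4 * σ * c) * lamn ^ 2 / (2 * lam2))
        * ‖Y (k + 1) - X (k + 1)‖ ^ 2 := by rw [hA]; ring
  have h1σ : 0 < 1 + σ := by positivity
  refine le_of_mul_le_mul_right ?_ h1σ
  rw [add_mul (_ / _) _ (1 + σ), div_mul_cancel₀ _ h1σ.ne']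
  have hψ : n * (w + 1 / (1 + σ) * A) * μ (k + 1) ^ 2 * (1 + σ) =
      ((1 + σ) * w + A) * (n * μ (k + 1) ^ 2) := by field_simp
  rw [hψ]
  clear_value A
  generalize ℓ ^ 2 / (v - σ * (c * lhn / 2) - (1 / β + 4 * σ) * (ℓ ^ 2 / (2 * c * lam2))) = t1 at *
  generalize (1 / β + 4 * σ) * ((c ^ 2 * lhn ^ 2 + 4 * ℓ ^ 2) / (c * lam2)) = t2 at *
  generalize (c * β⁻¹ + 4 * σ * c) * lamn ^ 2 / (2 * lam2) = t3 at *
  generalize δ / (1 - Real.sqrt δ) = t4 at *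
  linarith
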